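/- arXiv:0810.2247 — 2 statements merged into one kernel-verified Lean document; each statement's English description precedes it below -/
import Mathlib

section
/- For all integers m ≥ 0 and r ≥ 1, ∑_{k=0}^r [ C(m,k−1)^2 C(m,r−k)^2 + C(m,k−2) C(m,k) C(m,r−k)^2 ] ≥ 2 ∑_{k=0}^r C(m,k−1) C(m,k) C(m,r−k−1) C(m,r−k). -/
/-- The binomial coefficient `C(m, j)` for an integer index `j`, with the convention
that it vanishes for `j < 0` (and for `j > m`, as usual). -/
def Cz (m : ℕ) (j : ℤ) : ℤ := if 0 ≤ j then (Nat.choose m j.toNat : ℤ) else 0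

open Polynomial in
/-- The coefficient of `z ^ i` in `((1 + z) * (1 + X / z)) ^ m`, for `i ≥ 0`, as a polynomial
in `X`. -/
noncomputable def narayanaEntry : ℕ → ℕ → ℤ[X]
  | 0, 0 => 1
  | 0, _ + 1 => 0
  | m + 1, 0 => (1 + X) * narayanaEntry m 0 + 2 * X * narayanaEntry m 1
  | m + 1, i + 1 =>
      narayanaEntry m i + (1 + X) * narayanaEntry m (i + 1) + X * narayanaEntry m (i + 2)

open Polynomial in
theorem coeff_narayanaEntry (m i k : ℕ) :
    (narayanaEntry m i).coeff k = (m.choose (k + i) : ℤ) * m.choose k := by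
  induction m generalizing i k with
  | zero => cases i <;> cases k <;> simp [narayanaEntry, coeff_one, ← add_assoc]
  | succ m ih =>
    cases i <;> cases k <;>
      simp [narayanaEntry, add_mul, mul_assoc, coeff_ofNat_mul, coeff_X_mul, ih,
        Nat.choose_succ_succ, ← add_assoc, add_right_comm _ 1] <;> ring

open Polynomial in
/-- The polynomials with nonnegative integer coefficients. -/
noncomputable abbrev nonnegPolys : Subsemiring ℤ[X] := lifts (Nat.castRingHom ℤ)

open Polynomial in
theorem coeff_nonneg_of_mem_nonnegPolys {p : ℤ[X]} (hp : p ∈ nonnegPolys) (n : ℕ) :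
    0 ≤ p.coeff n := by
  obtain ⟨c, hc⟩ := (lifts_iff_coeff_lifts p).1 hp n
  rw [← hc]
  simp

open Polynomial in
theorem narayanaEntry_mem_nonnegPolys (m i : ℕ) : narayanaEntry m i ∈ nonnegPolys := by
  refine (lifts_iff_coeff_lifts _).2 fun k => ⟨m.choose (k + i) * m.choose k, ?_⟩
  simp [coeff_narayanaEntry]

open Polynomial in
/-- The `2 × 2` minor in columns `i`, `j` of the rows `m`, `m + 1` of `narayanaEntry`. -/
noncomputable def narayanaMinor (m i j : ℕ) : ℤ[X] :=
  narayanaEntry m i * narayanaEntry (m + 1) j - narayanaEntry m j * narayanaEntry (m + 1) i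

open Polynomial in
theorem narayanaMinor_mem_nonnegPolys (m : ℕ) {i j : ℕ} (hij : i < j) :
    narayanaMinor m i j ∈ nonnegPolys := by
  have hX : (X : ℤ[X]) ∈ nonnegPolys := X_mem_lifts _
  have hb : (1 + X : ℤ[X]) ∈ nonnegPolys := add_mem (one_mem _) hX
  have h2 : (2 : ℤ[X]) ∈ nonnegPolys := ofNat_mem _ 2
  induction m generalizing i j with
  | zero =>
    obtain ⟨j, rfl⟩ := Nat.exists_eq_succ_of_ne_zero (Nat.ne_zero_of_lt hij)
    rw [narayanaMinor, show narayanaEntry 0 (j + 1) = 0 from by simp [narayanaEntry], zero_mul,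
      sub_zero]
    exact mul_mem (narayanaEntry_mem_nonnegPolys _ _) (narayanaEntry_mem_nonnegPolys _ _)
  | succ m ih =>
    have le {a c : ℕ} (h : a ≤ c) : narayanaMinor m a c ∈ nonnegPolys := by
      rcases h.eq_or_lt with rfl | h
      · simp [narayanaMinor]
      · exact ih h
    obtain ⟨j, rfl⟩ := Nat.exists_eq_succ_of_ne_zero (Nat.ne_zero_of_lt hij)
    have row_zero (n : ℕ) : narayanaEntry (n + 1) 0 =
        (1 + X) * narayanaEntry n 0 + 2 * X * narayanaEntry n 1 := by rw [narayanaEntry]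
    have row_succ (n i : ℕ) : narayanaEntry (n + 1) (i + 1) = narayanaEntry n i +
        (1 + X) * narayanaEntry n (i + 1) + X * narayanaEntry n (i + 2) := by rw [narayanaEntry]
    rcases i with _ | i
    · rcases j with _ | j
      · have : narayanaMinor (m + 1) 0 1 = (1 + X * X) * narayanaMinor m 0 1 +
            (1 + X) * X * narayanaMinor m 0 2 + 2 * X * X * narayanaMinor m 1 2 := by
          simp only [narayanaMinor, row_zero (m + 1), row_succ (m + 1) 0, row_zero m,
            row_succ m]
          ring
        rw [this]
        have h01 := ih (i := 0) (j := 1) (by omega)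
        have h02 := ih (i := 0) (j := 2) (by omega)
        have h12 := ih (i := 1) (j := 2) (by omega)
        exact add_mem (add_mem (mul_mem (add_mem (one_mem _) (mul_mem hX hX)) h01)
          (mul_mem (mul_mem hb hX) h02)) (mul_mem (mul_mem (mul_mem h2 hX) hX) h12)
      · have : narayanaMinor (m + 1) 0 (j + 2) =
            (1 + X) * (narayanaMinor m 0 (j + 1) + (1 + X) * narayanaMinor m 0 (j + 2) +
              X * narayanaMinor m 0 (j + 3)) +
            2 * X * (narayanaMinor m 1 (j + 1) + (1 + X) * narayanaMinor m 1 (j + 2) +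
              X * narayanaMinor m 1 (j + 3)) := by
          simp only [narayanaMinor]
          rw [row_zero (m + 1), row_succ (m + 1) (j + 1), row_zero m, row_succ m (j + 1)]
          ring
        rw [this]
        have row (a : ℕ) (ha : a ≤ j + 1) : narayanaMinor m a (j + 1) +
            (1 + X) * narayanaMinor m a (j + 2) + X * narayanaMinor m a (j + 3) ∈ nonnegPolys :=
          add_mem (add_mem (le ha) (mul_mem hb (le (by omega)))) (mul_mem hX (le (by omega)))
        exact add_mem (mul_mem hb (row 0 (by omega)))
          (mul_mem (mul_mem h2 hX) (row 1 (by omega)))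
    · have expand (j : ℕ) : narayanaMinor (m + 1) (i + 1) (j + 1) =
          (narayanaMinor m i j + (1 + X) * narayanaMinor m i (j + 1) +
              X * narayanaMinor m i (j + 2)) +
            (1 + X) * (narayanaMinor m (i + 1) j + (1 + X) * narayanaMinor m (i + 1) (j + 1) +
              X * narayanaMinor m (i + 1) (j + 2)) +
            X * (narayanaMinor m (i + 2) j + (1 + X) * narayanaMinor m (i + 2) (j + 1) +
              X * narayanaMinor m (i + 2) (j + 2)) := by
        simp only [narayanaMinor]
        rw [row_succ (m + 1) i, row_succ (m + 1) j, row_succ m i, row_succ m j]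
        ring
      have row (a j : ℕ) (ha : a ≤ j) : narayanaMinor m a j +
          (1 + X) * narayanaMinor m a (j + 1) + X * narayanaMinor m a (j + 2) ∈ nonnegPolys :=
        add_mem (add_mem (le ha) (mul_mem hb (le (by omega)))) (mul_mem hX (le (by omega)))
      rcases (show i + 1 ≤ j by omega).eq_or_lt with rfl | h
      · have : narayanaMinor (m + 1) (i + 1) (i + 1 + 1) =
            (narayanaMinor m i (i + 1) + (1 + X) * narayanaMinor m i (i + 2) +
              X * narayanaMinor m i (i + 3)) +
            (1 + X + X * X) * narayanaMinor m (i + 1) (i + 2) +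
            (1 + X) * X * narayanaMinor m (i + 1) (i + 3) +
            X * X * narayanaMinor m (i + 2) (i + 3) := by
          rw [expand]
          simp only [narayanaMinor]
          ring
        rw [this]
        exact add_mem (add_mem (add_mem (row i (i + 1) (by omega))
          (mul_mem (add_mem hb (mul_mem hX hX)) (le (by omega))))
          (mul_mem (mul_mem hb hX) (le (by omega)))) (mul_mem (mul_mem hX hX) (le (by omega)))
      · rw [expand]
        exact add_mem (add_mem (row i j (by omega)) (mul_mem hb (row (i + 1) j (by omega))))
          (mul_mem hX (row (i + 2) j (by omega)))

open Polynomial in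
theorem X_mul_narayanaMinor_zero_one (m : ℕ) :
    X * narayanaMinor m 0 1 = X * narayanaEntry m 0 * narayanaEntry m 0 +
      X ^ 2 * narayanaEntry m 2 * narayanaEntry m 0 -
      2 * ((X * narayanaEntry m 1) * (X * narayanaEntry m 1)) := by
  rw [narayanaMinor, narayanaEntry, narayanaEntry]
  ring

open Polynomial in
theorem coeff_narayanaEntry_zero (m k : ℕ) : (narayanaEntry m 0).coeff k = Cz m k ^ 2 := by
  simp [coeff_narayanaEntry, Cz, sq]

open Polynomial in
theorem coeff_X_pow_mul_narayanaEntry (m i k : ℕ) :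
    (X ^ i * narayanaEntry m i).coeff k = Cz m ((k : ℤ) - i) * Cz m k := by
  rw [coeff_X_pow_mul']
  split_ifs with h
  · obtain ⟨k, rfl⟩ := Nat.exists_eq_add_of_le' h
    rw [Nat.add_sub_cancel, coeff_narayanaEntry, Nat.cast_add, add_sub_cancel_right,
      ← Nat.cast_add]
    simp only [Cz, Int.natCast_nonneg, if_true, Int.toNat_natCast]
    exact mul_comm _ _
  · have : ¬ (0 : ℤ) ≤ (k : ℤ) - i := by omega
    rw [Cz, if_neg this, zero_mul]

open Polynomial in
theorem coeff_X_mul_narayanaEntry_zero (m k : ℕ) :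
    (X * narayanaEntry m 0).coeff k = Cz m ((k : ℤ) - 1) ^ 2 := by
  cases k <;> simp [coeff_X_mul, coeff_narayanaEntry_zero, Cz]

/-- For all `m ≥ 0` and `r ≥ 1`,
`∑_{k=0}^r [C(m,k-1)^2 C(m,r-k)^2 + C(m,k-2) C(m,k) C(m,r-k)^2]
  ≥ 2 ∑_{k=0}^r C(m,k-1) C(m,k) C(m,r-k-1) C(m,r-k)`. -/
theorem choose_schur_positivity_ineq (m r : ℕ) (hr : 1 ≤ r) :
    2 * ∑ k ∈ Finset.range (r + 1),
        Cz m ((k : ℤ) - 1) * Cz m (k : ℤ) * Cz m ((r : ℤ) - k - 1) * Cz m ((r : ℤ) - k) ≤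
      ∑ k ∈ Finset.range (r + 1),
        (Cz m ((k : ℤ) - 1) ^ 2 * Cz m ((r : ℤ) - k) ^ 2 +
          Cz m ((k : ℤ) - 2) * Cz m (k : ℤ) * Cz m ((r : ℤ) - k) ^ 2) := by
  have h := coeff_nonneg_of_mem_nonnegPolys (mul_mem (Polynomial.X_mem_lifts _)
    (narayanaMinor_mem_nonnegPolys m zero_lt_one)) r
  have h1 (k : ℕ) := coeff_X_pow_mul_narayanaEntry m 1 k
  have h2 (k : ℕ) := coeff_X_pow_mul_narayanaEntry m 2 k
  simp only [pow_one, Nat.cast_one, Nat.cast_ofNat] at h1 h2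
  rw [X_mul_narayanaMinor_zero_one, Polynomial.coeff_sub, Polynomial.coeff_add,
    Polynomial.coeff_ofNat_mul] at h
  simp only [Polynomial.coeff_mul _ _ r, Finset.Nat.sum_antidiagonal_eq_sum_range_succ_mk,
    h1, h2, coeff_narayanaEntry_zero, coeff_X_mul_narayanaEntry_zero,
    ← Finset.sum_add_distrib] at h
  refine (le_of_eq ?_).trans ((sub_nonneg.1 h).trans (le_of_eq ?_))
  · congr 1
    refine Finset.sum_congr rfl fun k hk => ?_
    rw [Nat.cast_sub (Finset.mem_range_succ_iff.1 hk)]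
    ring
  · refine Finset.sum_congr rfl fun k hk => ?_
    rw [Nat.cast_sub (Finset.mem_range_succ_iff.1 hk)]
end

section
/- Fix integers m ≥ 1 and r ≥ 1, and work in ℤ[x_1,…,x_m] with e_j the j-th elementary symmetric polynomial (e_0 = 1, e_j = 0 for j < 0). Then ∑_{k=0}^r ( e_{k−1}^2 e_{r−k}^2 + e_{k−2} e_k e_{r−k}^2 − 2 e_{k−1} e_k e_{r−k−1} e_{r−k} ) = ∑_{λ} s_λ(x_1,…,x_m), where λ ranges over all partitions of 2r−2 whose parts all lie in {1,2,3,4} and in which each of the parts 1, 2 and 3 occurs an even number of times (the part 4 may occur any number of times), and s_λ(x_1,…,x_m) denotes the Schur polynomial of shape λ. -/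
/-- The `j`-th elementary symmetric polynomial in the variables `x_1, …, x_m`
(as an element of `ℤ[x_1,…,x_m]`), for an integer index `j`, with the convention
`e_0 = 1` and `e_j = 0` for `j < 0`. -/
noncomputable def E (m : ℕ) (j : ℤ) : MvPolynomial (Fin m) ℤ :=
  if 0 ≤ j then MvPolynomial.esymm (Fin m) ℤ j.toNat else 0

/-- The cells of the Young diagram whose `i`-th row (0-indexed) has length `L i`,
where all rows have index `< N` and length `≤ M`. -/
def cellsOf (L : ℕ → ℕ) (N M : ℕ) : Finset (ℕ × ℕ) :=
  (Finset.range N ×ˢ Finset.range M).filter fun p => p.2 < L p.1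

/-- A filling `T` of the cells of a shape with entries in `{1, …, m}`
(encoded as `Fin m`) is a semistandard Young tableau if it weakly increases
along each row and strictly increases down each column. -/
def IsSSYT (L : ℕ → ℕ) (N M m : ℕ) (T : {c // c ∈ cellsOf L N M} → Fin m) : Prop :=
  (∀ c c' : {c // c ∈ cellsOf L N M},
      (c : ℕ × ℕ).1 = (c' : ℕ × ℕ).1 → (c : ℕ × ℕ).2 ≤ (c' : ℕ × ℕ).2 → T c ≤ T c') ∧
  (∀ c c' : {c // c ∈ cellsOf L N M},
      (c : ℕ × ℕ).2 = (c' : ℕ × ℕ).2 → (c : ℕ × ℕ).1 < (c' : ℕ × ℕ).1 → T c < T c')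

instance (L : ℕ → ℕ) (N M m : ℕ) : DecidablePred (IsSSYT L N M m) := fun _ => by
  unfold IsSSYT; infer_instance

/-- The Schur polynomial `s_λ(x_1,…,x_m)` of the shape with row lengths `L`
(rows indexed by `i < N`, row lengths at most `M`): the sum, over all
semistandard Young tableaux `T` of that shape with entries in `{1,…,m}`, of the
monomial `∏_{cells c} x_{T c}`. -/
noncomputable def schur (m : ℕ) (L : ℕ → ℕ) (N M : ℕ) : MvPolynomial (Fin m) ℤ :=
  ∑ T ∈ Finset.univ.filter (IsSSYT L N M m),
    ∏ c : {c // c ∈ cellsOf L N M}, MvPolynomial.X (T c)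

/-- Row lengths of the partition `(4^{i4}, 3^{2 i3}, 2^{2 i2}, 1^{2 i1})`. -/
def rl (i4 i3 i2 i1 : ℕ) : ℕ → ℕ := fun i =>
  if i < i4 then 4
  else if i < i4 + 2 * i3 then 3
  else if i < i4 + 2 * i3 + 2 * i2 then 2
  else if i < i4 + 2 * i3 + 2 * i2 + 2 * i1 then 1
  else 0

section DualJacobiTrudi

open Finset

variable {R : Type*} [CommRing R]

/-- The elementary symmetric polynomials evaluated at `x`, extended by zero to negative indices. -/
noncomputable def esymmInt {m : ℕ} (x : Fin m → R) (j : ℤ) : R :=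
  if 0 ≤ j then ((univ : Finset (Fin m)).val.map x).esymm j.toNat else 0

lemma esymmInt_of_neg {m : ℕ} (x : Fin m → R) {j : ℤ} (hj : j < 0) : esymmInt x j = 0 :=
  if_neg (by omega)

lemma esymmInt_eq_E (m : ℕ) (j : ℤ) :
    E m j = esymmInt (MvPolynomial.X : Fin m → MvPolynomial (Fin m) ℤ) j := by
  rw [E, esymmInt, MvPolynomial.esymm_eq_multiset_esymm]

lemma esymmInt_fin_zero (x : Fin 0 → R) (j : ℤ) : esymmInt x j = if j = 0 then 1 else 0 := by
  rcases lt_trichotomy j 0 with hj | rfl | hj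
  · rw [esymmInt_of_neg x hj, if_neg hj.ne]
  · simp [esymmInt, Multiset.esymm]
  · obtain ⟨k, rfl⟩ : ∃ k : ℕ, j = k + 1 := ⟨(j - 1).toNat, by omega⟩
    rw [esymmInt, if_pos hj.le, if_neg hj.ne', show ((k : ℤ) + 1).toNat = k + 1 by omega]
    simp [Multiset.esymm, Multiset.powersetCard_zero_right]

lemma esymmInt_fin_succ {m : ℕ} (x : Fin (m + 1) → R) (j : ℤ) :
    esymmInt x j =
      esymmInt (fun i => x i.castSucc) j
        + x (Fin.last m) * esymmInt (fun i => x i.castSucc) (j - 1) := by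
  have hx : (univ : Finset (Fin (m + 1))).val.map x
      = x (Fin.last m) ::ₘ (univ : Finset (Fin m)).val.map fun i => x i.castSucc := by
    rw [Fin.univ_castSuccEmb, cons_val, Multiset.map_cons, map_val, Multiset.map_map]
    rfl
  rcases lt_trichotomy j 0 with hj | rfl | hj
  · rw [esymmInt_of_neg _ hj, esymmInt_of_neg _ hj, esymmInt_of_neg _ (by omega)]
    ring
  · rw [esymmInt_of_neg _ (show (0 : ℤ) - 1 < 0 by omega)]
    simp [esymmInt, Multiset.esymm]
  · obtain ⟨k, rfl⟩ : ∃ k : ℕ, j = k + 1 := ⟨(j - 1).toNat, by omega⟩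
    rw [esymmInt, esymmInt, esymmInt, if_pos hj.le, if_pos hj.le, if_pos (by omega), hx,
      show ((k : ℤ) + 1).toNat = k + 1 by omega, show ((k : ℤ) + 1 - 1).toNat = k by omega]
    simp only [Multiset.esymm, Multiset.powersetCard_cons, Multiset.map_add, Multiset.sum_add,
      Multiset.map_map, Function.comp_def, Multiset.prod_cons, Multiset.sum_map_mul_left]

/-- The determinant of the matrix with entries `e (p i + j)`. -/
def shiftDet {n : ℕ} (e : ℤ → R) (p : Fin n → ℤ) : R :=
  (Matrix.of fun i j : Fin n => e (p i + j)).det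

lemma shiftDet_eq_sum_finset {n : ℕ} {e e' : ℤ → R} {y : R}
    (he : ∀ j, e j = e' j + y * e' (j - 1)) (p : Fin n → ℤ) :
    shiftDet e p =
      ∑ s : Finset (Fin n), y ^ #s * shiftDet e' fun i => p i - if i ∈ s then 1 else 0 := by
  let row : ℤ → Fin n → R := fun q j => e' (q + j)
  have hrow : (Matrix.of fun i j : Fin n => e (p i + j))
      = (fun i => y • row (p i - 1)) + fun i => row (p i) := by
    ext i j
    simp [row, he, add_comm, sub_eq_add_neg, add_assoc, add_left_comm]
  have hdet (M : Matrix (Fin n) (Fin n) R) :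
      M.det = (Matrix.detRowAlternating (R := R)).toMultilinearMap M := rfl
  rw [shiftDet, hdet, hrow, MultilinearMap.map_add_univ]
  refine sum_congr rfl fun s _ => ?_
  have hs : s.piecewise (fun i => y • row (p i - 1)) (fun i => row (p i))
      = s.piecewise (fun i => y • row (p i - if i ∈ s then 1 else 0))
          (fun i => row (p i - if i ∈ s then 1 else 0)) := by
    ext i : 1
    by_cases hi : i ∈ s <;> simp [hi]
  rw [hs]
  have := MultilinearMap.map_piecewise_smul
    (Matrix.detRowAlternating (R := R) (n := Fin n)).toMultilinearMap (fun _ => y)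
    (fun i => row (p i - if i ∈ s then 1 else 0)) s
  rw [this, prod_const, smul_eq_mul]
  rfl

/-- The row indices of the dual Jacobi–Trudi matrix of the shape with column lengths `C`. -/
def colIndex {n : ℕ} (C : Fin n → ℕ) (i : Fin n) : ℤ := C i - i

/-- The cells of the diagram with column lengths `C`. -/
def IsColumnDiagram {n : ℕ} (C : Fin n → ℕ) (A : Finset (ℕ × ℕ)) : Prop :=
  ∀ c : ℕ × ℕ, c ∈ A ↔ ∃ h : c.2 < n, c.1 < C ⟨c.2, h⟩

/-- The column lengths after removing the bottom cell of each column in `s`. -/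
def removeBottom {n : ℕ} (C : Fin n → ℕ) (s : Finset (Fin n)) (i : Fin n) : ℕ :=
  C i - if i ∈ s then 1 else 0

/-- Removing the bottom cells of the columns in `s` is possible and leaves a partition. -/
def IsRemovable {n : ℕ} (C : Fin n → ℕ) (s : Finset (Fin n)) : Prop :=
  (∀ i ∈ s, 0 < C i) ∧ Antitone (removeBottom C s)

lemma shiftDet_eq_zero_of_not_isRemovable {n : ℕ} {e : ℤ → R} (he : ∀ j < 0, e j = 0)
    {C : Fin (n + 1) → ℕ} (hC : Antitone C) {s : Finset (Fin (n + 1))} (hs : ¬ IsRemovable C s) :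
    shiftDet e (fun i => colIndex C i - if i ∈ s then 1 else 0) = 0 := by
  by_cases hadj : ∃ i : Fin n, C i.castSucc = C i.succ ∧ i.castSucc ∈ s ∧ i.succ ∉ s
  · obtain ⟨i, hCi, hi, hi'⟩ := hadj
    refine Matrix.det_zero_of_row_eq (i := i.castSucc) (j := i.succ) (by simp [Fin.ext_iff]) ?_
    ext j
    simp only [Matrix.of_apply, colIndex, hCi, hi, hi', if_true, if_false]
    congr 1
    simp
    ring
  by_cases hlast : C (Fin.last n) = 0 ∧ Fin.last n ∈ s
  · refine Matrix.det_eq_zero_of_row_eq_zero (Fin.last n) fun j => he _ ?_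
    have := j.is_lt
    simp only [colIndex, hlast, Fin.val_last, if_true]
    omega
  refine absurd ⟨fun i => ?_, Fin.antitone_iff_succ_le.2 fun i => ?_⟩ hs
  · induction i using Fin.reverseInduction with
    | last => intro h; by_contra h'; exact hlast ⟨by omega, h⟩
    | cast i ih =>
      intro h
      by_contra h'
      have h1 := hC (Fin.castSucc_lt_succ (i := i)).le
      by_cases h2 : i.succ ∈ s
      · have := ih h2
        omega
      · exact hadj ⟨i, by omega, h, h2⟩
  · have h1 := hC (Fin.castSucc_lt_succ (i := i)).le
    have h2 : ¬ (C i.castSucc = C i.succ ∧ i.castSucc ∈ s ∧ i.succ ∉ s) := fun h => hadj ⟨i, h⟩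
    unfold removeBottom
    split_ifs with h3 h4 h4 <;> grind

/-- Semistandard fillings of a finite set of cells. -/
def IsTableau {m : ℕ} (A : Finset (ℕ × ℕ)) (T : {c // c ∈ A} → Fin m) : Prop :=
  (∀ c c' : {c // c ∈ A},
      (c : ℕ × ℕ).1 = (c' : ℕ × ℕ).1 → (c : ℕ × ℕ).2 ≤ (c' : ℕ × ℕ).2 → T c ≤ T c') ∧
  (∀ c c' : {c // c ∈ A},
      (c : ℕ × ℕ).2 = (c' : ℕ × ℕ).2 → (c : ℕ × ℕ).1 < (c' : ℕ × ℕ).1 → T c < T c')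

open Classical in
/-- The generating function of the semistandard fillings of `A`. -/
noncomputable def tableauSum {m : ℕ} (x : Fin m → R) (A : Finset (ℕ × ℕ)) : R :=
  ∑ T : {c // c ∈ A} → Fin m with IsTableau A T, ∏ c, x (T c)

lemma schur_eq_tableauSum (m : ℕ) (L : ℕ → ℕ) (N M : ℕ) :
    schur m L N M = tableauSum MvPolynomial.X (cellsOf L N M) := by
  unfold schur tableauSum
  congr!

/-- The columns of a filling that contain the largest available entry. -/
noncomputable def lastColumns {n m : ℕ} {A : Finset (ℕ × ℕ)}
    (T : {c // c ∈ A} → Fin (m + 1)) : Finset (Fin n) := by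
  classical exact {j | ∃ c : {c // c ∈ A}, (c : ℕ × ℕ).2 = j ∧ T c = Fin.last m}

lemma mem_lastColumns {n m : ℕ} {A : Finset (ℕ × ℕ)} {T : {c // c ∈ A} → Fin (m + 1)}
    {j : Fin n} :
    j ∈ lastColumns T ↔ ∃ c : {c // c ∈ A}, (c : ℕ × ℕ).2 = j ∧ T c = Fin.last m := by
  simp [lastColumns]

/-- Extend a filling of `B` to `A` by the largest entry. -/
def extendLast {m : ℕ} {A B : Finset (ℕ × ℕ)} (T : {c // c ∈ B} → Fin m) (c : {c // c ∈ A}) :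
    Fin (m + 1) :=
  if h : (c : ℕ × ℕ) ∈ B then (T ⟨c, h⟩).castSucc else Fin.last m

lemma prod_extendLast {m : ℕ} {A B : Finset (ℕ × ℕ)} (hBA : B ⊆ A) (x : Fin (m + 1) → R)
    (T : {c // c ∈ B} → Fin m) :
    ∏ c : {c // c ∈ A}, x (extendLast T c) =
      x (Fin.last m) ^ #(A \ B) * ∏ c, x (T c).castSucc := by
  let g : ℕ × ℕ → R := fun c => if h : c ∈ B then x (T ⟨c, h⟩).castSucc else x (Fin.last m)
  have h1 : ∀ c : {c // c ∈ A}, x (extendLast T c) = g c := by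
    intro c
    unfold extendLast g
    split_ifs <;> rfl
  have h2 : ∀ c : {c // c ∈ B}, x (T c).castSucc = g c := by
    intro c
    simp [g]
  rw [Fintype.prod_congr _ _ h1, Fintype.prod_congr _ _ h2, prod_coe_sort, prod_coe_sort,
    ← prod_sdiff hBA]
  congr 1
  refine prod_eq_pow_card fun c hc => dif_neg (mem_sdiff.1 hc).2

lemma isColumnDiagram_filter {n : ℕ} {C C' : Fin n → ℕ} {A : Finset (ℕ × ℕ)}
    (hA : IsColumnDiagram C A) (hC : ∀ i, C' i ≤ C i) :
    IsColumnDiagram C' (A.filter fun c => ∃ h : c.2 < n, c.1 < C' ⟨c.2, h⟩) := by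
  intro c
  rw [mem_filter, hA]
  exact ⟨fun h => h.2, fun ⟨h, h'⟩ => ⟨⟨h, h'.trans_le (hC _)⟩, h, h'⟩⟩

section Branching

variable {n : ℕ} {C : Fin n → ℕ} {s : Finset (Fin n)} {A B : Finset (ℕ × ℕ)}

lemma subset_of_removeBottom (hA : IsColumnDiagram C A)
    (hB : IsColumnDiagram (removeBottom C s) B) : B ⊆ A := by
  intro c hc
  obtain ⟨h, h'⟩ := (hB c).1 hc
  exact (hA c).2 ⟨h, h'.trans_le (Nat.sub_le _ _)⟩

lemma mem_iff_of_removeBottom (hs : IsRemovable C s) (hA : IsColumnDiagram C A)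
    (hB : IsColumnDiagram (removeBottom C s) B) {c : ℕ × ℕ} (hc : c ∈ A) :
    c ∉ B ↔ ∃ j ∈ s, c = (C j - 1, (j : ℕ)) := by
  obtain ⟨h, h'⟩ := (hA c).1 hc
  rw [hB]
  unfold removeBottom
  constructor
  · intro hn
    push Not at hn
    have h2 := hn h
    split_ifs at h2 with hj
    · exact ⟨_, hj, Prod.ext (by simp only; omega) rfl⟩
    · omega
  · rintro ⟨j, hj, rfl⟩ ⟨h1, h2⟩
    have := hs.1 j hj
    simp only [Fin.eta, hj, if_true] at h2
    omega

lemma card_sdiff_of_removeBottom (hs : IsRemovable C s) (hA : IsColumnDiagram C A)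
    (hB : IsColumnDiagram (removeBottom C s) B) : #(A \ B) = #s := by
  symm
  refine card_nbij (fun j => (C j - 1, (j : ℕ))) (fun j hj => ?_) (fun j _ j' _ h => ?_)
    fun c hc => ?_
  · have hjA : (C j - 1, (j : ℕ)) ∈ A :=
      (hA _).2 ⟨j.is_lt, by have := hs.1 j hj; simp only [Fin.eta]; omega⟩
    exact mem_sdiff.2 ⟨hjA, (mem_iff_of_removeBottom hs hA hB hjA).2 ⟨j, hj, rfl⟩⟩
  · exact Fin.ext (Prod.ext_iff.1 h).2
  · obtain ⟨hcA, hcB⟩ := mem_sdiff.1 hc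
    obtain ⟨j, hj, rfl⟩ := (mem_iff_of_removeBottom hs hA hB hcA).1 hcB
    exact ⟨j, hj, rfl⟩

variable {m : ℕ} {T : {c // c ∈ A} → Fin (m + 1)}

lemma eq_bottom_of_eq_last (hA : IsColumnDiagram C A) (hT : IsTableau A T) {c : {c // c ∈ A}}
    (hc : T c = Fin.last m) (j : Fin n) (hj : (c : ℕ × ℕ).2 = j) :
    (c : ℕ × ℕ) = (C j - 1, (j : ℕ)) ∧ 0 < C j := by
  obtain ⟨⟨a, b⟩, hab⟩ := c
  simp only at hj
  subst hj
  obtain ⟨_, h⟩ := (hA _).1 hab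
  simp only [Fin.eta] at h
  by_contra hcon
  have hmem : (a + 1, (j : ℕ)) ∈ A := (hA _).2 ⟨j.is_lt, by
    simp only [Fin.eta, Prod.mk.injEq, and_true] at hcon ⊢; omega⟩
  have := hT.2 ⟨_, hab⟩ ⟨_, hmem⟩ rfl (Nat.lt_succ_self a)
  rw [hc] at this
  exact absurd this (Fin.le_last _).not_gt

lemma isRemovable_lastColumns (hC : Antitone C) (hA : IsColumnDiagram C A) (hT : IsTableau A T) :
    IsRemovable C (lastColumns T) := by
  refine ⟨fun i hi => ?_, fun i j hij => ?_⟩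
  · obtain ⟨c, hci, hc⟩ := mem_lastColumns.1 hi
    exact (eq_bottom_of_eq_last hA hT hc i hci).2
  · have hle := hC hij
    unfold removeBottom
    split_ifs with hj hi hi
    · omega
    · omega
    · by_contra hlt
      have heq : C i = C j := by omega
      obtain ⟨c, hci, hc⟩ := mem_lastColumns.1 hi
      obtain ⟨hcb, hpos⟩ := eq_bottom_of_eq_last hA hT hc i hci
      have hmem : (C j - 1, (j : ℕ)) ∈ A :=
        (hA _).2 ⟨j.is_lt, by simp only [Fin.eta]; omega⟩
      refine hj (mem_lastColumns.2 ⟨⟨_, hmem⟩, rfl, ?_⟩)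
      have := hT.1 c ⟨_, hmem⟩ (by rw [hcb, heq]) (by rw [hcb]; exact hij)
      exact Fin.last_le_iff.1 (hc ▸ this)
    · omega

lemma eq_last_iff_of_lastColumns (hC : Antitone C) (hA : IsColumnDiagram C A)
    (hT : IsTableau A T) (hs : lastColumns T = s) (hB : IsColumnDiagram (removeBottom C s) B)
    (c : {c // c ∈ A}) : T c = Fin.last m ↔ (c : ℕ × ℕ) ∉ B := by
  have hrem := isRemovable_lastColumns hC hA hT
  rw [hs] at hrem
  rw [mem_iff_of_removeBottom hrem hA hB c.2]
  constructor
  · intro hc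
    obtain ⟨h, -⟩ := (hA _).1 c.2
    exact ⟨⟨_, h⟩, hs ▸ mem_lastColumns.2 ⟨c, rfl, hc⟩,
      (eq_bottom_of_eq_last hA hT hc ⟨_, h⟩ rfl).1⟩
  · rintro ⟨j, hj, hcj⟩
    obtain ⟨c', hcj', hc'⟩ := mem_lastColumns.1 (hs ▸ hj)
    rwa [show c = c' from Subtype.ext (hcj.trans (eq_bottom_of_eq_last hA hT hc' j hcj').1.symm)]

lemma isTableau_extendLast (hs : IsRemovable C s) (hA : IsColumnDiagram C A)
    (hB : IsColumnDiagram (removeBottom C s) B) {T : {c // c ∈ B} → Fin m} (hT : IsTableau B T) :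
    IsTableau A (extendLast T) := by
  refine ⟨fun c c' h1 h2 => ?_, fun c c' h1 h2 => ?_⟩
  · by_cases hc' : (c' : ℕ × ℕ) ∈ B
    · have hc : (c : ℕ × ℕ) ∈ B := by
        obtain ⟨h, h'⟩ := (hB _).1 hc'
        refine (hB _).2 ⟨h2.trans_lt h, ?_⟩
        rw [h1]
        exact h'.trans_le (hs.2 h2)
      simpa [extendLast, hc, hc'] using hT.1 ⟨c, hc⟩ ⟨c', hc'⟩ h1 h2
    · simpa [extendLast, hc'] using Fin.le_last _
  · have hc : (c : ℕ × ℕ) ∈ B := by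
      by_contra hc
      obtain ⟨j, hj, hcj⟩ := (mem_iff_of_removeBottom hs hA hB c.2).1 hc
      obtain ⟨h, h'⟩ := (hA _).1 c'.2
      have hj' : (⟨_, h⟩ : Fin n) = j := Fin.ext (h1.symm.trans (by rw [hcj]))
      rw [hj'] at h'
      rw [hcj] at h2
      simp only at h2
      omega
    by_cases hc' : (c' : ℕ × ℕ) ∈ B
    · simpa [extendLast, hc, hc'] using hT.2 ⟨c, hc⟩ ⟨c', hc'⟩ h1 h2
    · simp [extendLast, hc, hc']

lemma lastColumns_extendLast (hs : IsRemovable C s) (hA : IsColumnDiagram C A)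
    (hB : IsColumnDiagram (removeBottom C s) B) (T : {c // c ∈ B} → Fin m) :
    lastColumns (n := n) (extendLast (A := A) T) = s := by
  have hlast (c : {c // c ∈ A}) : extendLast T c = Fin.last m ↔ (c : ℕ × ℕ) ∉ B := by
    by_cases hc : (c : ℕ × ℕ) ∈ B
    · simp [extendLast, hc]
    · simp [extendLast, hc]
  ext j
  simp only [mem_lastColumns, hlast]
  constructor
  · rintro ⟨c, hcj, hc⟩
    obtain ⟨j', hj', h⟩ := (mem_iff_of_removeBottom hs hA hB c.2).1 hc
    rwa [show j = j' from Fin.ext (by rw [← hcj, h])]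
  · intro hj
    have hmem : (C j - 1, (j : ℕ)) ∈ A :=
      (hA _).2 ⟨j.is_lt, by have := hs.1 j hj; simp only [Fin.eta]; omega⟩
    exact ⟨⟨_, hmem⟩, rfl, (mem_iff_of_removeBottom hs hA hB hmem).2 ⟨j, hj, rfl⟩⟩

open Classical in
lemma sum_tableaux_lastColumns_eq (hC : Antitone C) (hs : IsRemovable C s)
    (hA : IsColumnDiagram C A) (hB : IsColumnDiagram (removeBottom C s) B)
    (x : Fin (m + 1) → R) :
    ∑ T ∈ ({T | IsTableau A T} : Finset ({c // c ∈ A} → Fin (m + 1))) with lastColumns T = s,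
        ∏ c, x (T c) =
      x (Fin.last m) ^ #s * tableauSum (fun i => x i.castSucc) B := by
  have hBA := subset_of_removeBottom hA hB
  rw [tableauSum, mul_sum]
  symm
  refine sum_nbij extendLast (fun T hT => ?_) (fun T _ T' _ h => ?_) (fun T hT => ?_)
    fun T hT => ?_
  · simp only [mem_filter, mem_univ, true_and] at hT ⊢
    exact ⟨isTableau_extendLast hs hA hB hT, lastColumns_extendLast hs hA hB T⟩
  · ext c : 1
    simpa [extendLast] using congrFun h ⟨c, hBA c.2⟩
  · simp only [coe_filter, mem_filter, mem_univ, true_and, Set.mem_ofPred_eq] at hT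
    have hlast := eq_last_iff_of_lastColumns hC hA hT.1 hT.2 hB
    have hne (c : {c // c ∈ B}) : T ⟨c, hBA c.2⟩ ≠ Fin.last m := fun h => (hlast _).1 h c.2
    refine ⟨fun c => (T ⟨c, hBA c.2⟩).castPred (hne c), ?_, ?_⟩
    · simp only [coe_filter, mem_univ, true_and, Set.mem_ofPred_eq]
      exact ⟨fun c c' h h' => Fin.castPred_le_castPred_iff.2 (hT.1.1 _ _ h h'),
        fun c c' h h' => Fin.castPred_lt_castPred_iff.2 (hT.1.2 _ _ h h')⟩
    · ext c : 1
      by_cases hc : (c : ℕ × ℕ) ∈ B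
      · simp [extendLast, hc]
      · simpa [extendLast, hc] using ((hlast c).2 hc).symm
  · rw [prod_extendLast hBA, card_sdiff_of_removeBottom hs hA hB]

end Branching

/-- The dual Jacobi–Trudi formula. -/
theorem tableauSum_eq_shiftDet {n m : ℕ} (x : Fin m → R) {C : Fin (n + 1) → ℕ} (hC : Antitone C)
    {A : Finset (ℕ × ℕ)} (hA : IsColumnDiagram C A) :
    tableauSum x A = shiftDet (esymmInt x) (colIndex C) := by
  classical
  induction m generalizing C A with
  | zero =>
    by_cases h0 : C 0 = 0
    · have hCi (i) : C i = 0 := Nat.le_zero.1 (h0 ▸ hC (Fin.zero_le i))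
      have hAe : A = ∅ := by
        ext c
        simp [hA c, hCi]
      subst hAe
      have hdet : shiftDet (esymmInt x) (colIndex C) = 1 := by
        rw [shiftDet, Matrix.det_of_isUpperTriangular]
        · simp [colIndex, hCi, esymmInt_fin_zero]
        · intro i j hij
          simp only [id_eq] at hij
          simp only [Matrix.of_apply, colIndex, hCi]
          exact esymmInt_of_neg x (by have : (j : ℕ) < i := hij; omega)
      rw [hdet, tableauSum, filter_true_of_mem fun T _ => ⟨fun c => (notMem_empty _ c.2).elim,
        fun c => (notMem_empty _ c.2).elim⟩]
      simp
    · have hmem : ((0, 0) : ℕ × ℕ) ∈ A := (hA _).2 ⟨Nat.succ_pos n, Nat.pos_of_ne_zero h0⟩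
      have : IsEmpty ({c // c ∈ A} → Fin 0) := ⟨fun T => (T ⟨_, hmem⟩).elim0⟩
      rw [tableauSum, univ_eq_empty, filter_empty, sum_empty, shiftDet]
      refine (Matrix.det_eq_zero_of_row_eq_zero 0 fun j => ?_).symm
      rw [Matrix.of_apply, esymmInt_fin_zero, if_neg]
      simp only [colIndex, Fin.val_zero]
      omega
  | succ m ih =>
    rw [shiftDet_eq_sum_finset (esymmInt_fin_succ x), tableauSum,
      ← sum_fiberwise _ (lastColumns (n := n + 1))]
    refine sum_congr rfl fun s _ => ?_
    by_cases hs : IsRemovable C s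
    · have hB := isColumnDiagram_filter hA (C' := removeBottom C s) fun i => Nat.sub_le _ _
      rw [sum_tableaux_lastColumns_eq hC hs hA hB, ih _ hs.2 hB]
      congr 2
      ext i
      unfold colIndex removeBottom
      split_ifs with hi
      · have := hs.1 i hi
        omega
      · simp
    · rw [shiftDet_eq_zero_of_not_isRemovable (fun j => esymmInt_of_neg _) hC hs, mul_zero]
      refine sum_eq_zero fun T hT => absurd ?_ hs
      simp only [mem_filter, mem_univ, true_and] at hT
      exact hT.2 ▸ isRemovable_lastColumns hC hA hT.1

end DualJacobiTrudi

section ShuffleSum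

open Finset

variable {R : Type*} [CommRing R]

lemma sum_interleavings (s : Finset ℕ) (g : ℕ → ℕ → ℕ → ℕ → R)
    (h₁₂ : ∀ a b c d, g b a c d = -g a b c d) (h₂₃ : ∀ a b c d, g a c b d = -g a b c d)
    (h₃₄ : ∀ a b c d, g a b d c = -g a b c d) (h₀ : ∀ a b d, g a b b d = 0) :
    ∑ a ∈ s, ∑ b ∈ s, ∑ c ∈ s, ∑ d ∈ s,
        (if b < a ∧ d < c ∧ Odd (a + b) ∧ Odd (c + d) then g a b c d else 0) =
      4 * ∑ a ∈ s, ∑ b ∈ s, ∑ c ∈ s, ∑ d ∈ s,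
        if d < c ∧ c < b ∧ b < a ∧ Odd (a + b) ∧ Odd (b + c) ∧ Odd (c + d)
          then g a b c d else 0 := by
  let Q : (ℕ → ℕ → ℕ → ℕ → R) → R := fun f => ∑ a ∈ s, ∑ b ∈ s, ∑ c ∈ s, ∑ d ∈ s, f a b c d
  have q₁₂ (f) : Q f = Q fun a b c d => f b a c d := sum_comm
  have q₂₃ (f) : Q f = Q fun a b c d => f a c b d := sum_congr rfl fun _ _ => sum_comm
  have q₃₄ (f) : Q f = Q fun a b c d => f a b d c :=
    sum_congr rfl fun _ _ => sum_congr rfl fun _ _ => sum_comm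
  have qadd (f f') : Q f + Q f' = Q fun a b c d => f a b c d + f' a b c d := by
    simp only [Q, sum_add_distrib]
  have qsub (f f') : Q f - Q f' = Q fun a b c d => f a b c d - f' a b c d := by
    simp only [Q, sum_sub_distrib]
  let u : ℕ → ℕ → R := fun a b => if Odd (a + b) then 1 else 0
  let G : ℕ → ℕ → ℕ → ℕ → R := fun a b c d => if d < c ∧ c < b ∧ b < a then g a b c d else 0
  have hsplit : (Q fun a b c d => if b < a ∧ d < c ∧ Odd (a + b) ∧ Odd (c + d)
        then g a b c d else 0) =
      (Q fun a b c d => u a b * u c d * G a b c d) + (Q fun a b c d => u a b * u c d * G c d a b)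
        - (Q fun a b c d => u a b * u c d * G a c b d)
        + (Q fun a b c d => u a b * u c d * G a c d b)
        + (Q fun a b c d => u a b * u c d * G c a b d)
        - Q fun a b c d => u a b * u c d * G c a d b := by
    rw [qadd, qsub, qadd, qadd, qsub]
    congr 1
    ext a b c d
    have e1 : g c d a b = g a b c d := by
      rw [h₂₃, h₁₂, h₃₄, h₂₃]; ring
    have e2 : g a c d b = g a b c d := by rw [h₃₄, h₂₃]; ring
    have e3 : g c a b d = g a b c d := by rw [h₁₂, h₂₃]; ring
    have e4 : g c a d b = -g a b c d := by rw [h₃₄, e3]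
    simp only [G, h₂₃ a b c d, e1, e2, e3, e4]
    have hu' : (if b < a ∧ d < c ∧ Odd (a + b) ∧ Odd (c + d) then g a b c d else 0)
        = u a b * u c d * if b < a ∧ d < c then g a b c d else 0 := by
      simp only [u]
      split_ifs <;> first | omega | tauto | simp
    rw [hu', ← mul_add, ← mul_sub, ← mul_add, ← mul_add, ← mul_sub]
    congr 1
    by_cases hz : b = c ∨ a = c ∨ b = d ∨ a = d
    · have : g a b c d = 0 := by
        rcases hz with rfl | rfl | rfl | rfl
        · exact h₀ _ _ _
        · rw [h₁₂, h₀, neg_zero]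
        · rw [h₃₄, h₀, neg_zero]
        · rw [h₁₂, h₃₄, h₀, neg_zero, neg_zero]
      simp [this]
    · split_ifs <;> first | omega | simp
  have r1 : (Q fun a b c d => u a b * u c d * G c d a b)
      = Q fun a b c d => u a b * u c d * G a b c d := by
    rw [q₂₃, q₁₂, q₃₄, q₂₃]
    simp only [mul_comm (u _ _) (u _ _)]
  have r2 : (Q fun a b c d => u a b * u c d * G a c b d)
      = Q fun a b c d => u a c * u b d * G a b c d := q₂₃ _
  have r3 : (Q fun a b c d => u a b * u c d * G a c d b)
      = Q fun a b c d => u a d * u b c * G a b c d := by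
    rw [q₂₃, q₃₄]
  have r4 : (Q fun a b c d => u a b * u c d * G c a b d)
      = Q fun a b c d => u a d * u b c * G a b c d := by
    rw [q₂₃, q₁₂]
    simp only [mul_comm (u _ _) (u _ _)]
  have r5 : (Q fun a b c d => u a b * u c d * G c a d b)
      = Q fun a b c d => u a c * u b d * G a b c d := by
    rw [q₂₃, q₁₂, q₃₄]
    simp only [mul_comm (u _ _) (u _ _)]
  have hfour (f) : 4 * Q f = Q f + Q f + Q f + Q f := by ring
  change Q _ = 4 * Q _
  rw [hsplit, r1, r2, r3, r4, r5, hfour, qadd, qsub, qadd, qadd, qsub, qadd, qadd, qadd]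
  congr 1
  ext a b c d
  have hodd (x y : ℕ) : Odd (x + y) ↔ ¬ (Even x ↔ Even y) := by
    rw [← Nat.not_even_iff_odd, Nat.even_add]
  simp only [u, G, hodd]
  by_cases ha : Even a <;> by_cases hb : Even b <;> by_cases hc : Even c <;>
    by_cases hd : Even d <;> simp [ha, hb, hc, hd]

lemma sum_mul_sum_odd_pairs {K : ℕ} (φ ψ : ℕ → ℕ → R) (s : Finset ℕ) :
    ∑ a ∈ s, ∑ b ∈ s, ∑ c ∈ s, ∑ d ∈ s,
        (if b < a ∧ d < c ∧ Odd (a + b) ∧ Odd (c + d)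
          then (if a + b + c + d = 2 * K + 2 then φ a b * ψ c d else 0) else 0) =
      ∑ M ∈ range (K + 1),
        (∑ a ∈ s, ∑ b ∈ s, if b < a ∧ a + b = 2 * M + 1 then φ a b else 0) *
          ∑ a ∈ s, ∑ b ∈ s, if b < a ∧ a + b = 2 * (K - M) + 1 then ψ a b else 0 := by
  have hexp (f f' : ℕ → ℕ → R) : (∑ a ∈ s, ∑ b ∈ s, f a b) * ∑ c ∈ s, ∑ d ∈ s, f' c d =
      ∑ a ∈ s, ∑ b ∈ s, ∑ c ∈ s, ∑ d ∈ s, f a b * f' c d := by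
    rw [sum_mul_sum]
    refine sum_congr rfl fun a _ => ?_
    simp only [sum_mul_sum]
    exact sum_comm
  simp only [hexp]
  symm
  rw [sum_comm]
  refine sum_congr rfl fun a _ => ?_
  rw [sum_comm]
  refine sum_congr rfl fun b _ => ?_
  rw [sum_comm]
  refine sum_congr rfl fun c _ => ?_
  rw [sum_comm]
  refine sum_congr rfl fun d _ => ?_
  by_cases h : b < a ∧ d < c ∧ Odd (a + b) ∧ Odd (c + d) ∧ a + b + c + d = 2 * K + 2
  · obtain ⟨h1, h2, ⟨M, hM⟩, ⟨M', hM'⟩, h5⟩ := h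
    rw [sum_eq_single M, if_pos ⟨h1, hM⟩, if_pos ⟨h2, by omega⟩,
      if_pos ⟨h1, h2, ⟨M, hM⟩, M', hM'⟩, if_pos h5]
    · intro M₁ _ hM₁
      rw [if_neg (by omega), zero_mul]
    · intro hM₁
      exact absurd (mem_range.2 (by omega)) hM₁
  · rw [sum_eq_zero]
    · split_ifs <;> tauto
    · intro M hM
      rw [mem_range] at hM
      split_ifs with h1 h2
      · exact absurd ⟨h1.1, h2.1, ⟨M, h1.2⟩, ⟨K - M, h2.2⟩, by omega⟩ h
      all_goals simp

lemma sum_pairs_eq_sum_range {M N : ℕ} (hN : 2 * M + 1 < N) (f : ℕ → ℕ → R) :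
    ∑ a ∈ range N, ∑ b ∈ range N, (if b < a ∧ a + b = 2 * M + 1 then f a b else 0) =
      ∑ i ∈ range (M + 1), f (M + 1 + i) (M - i) := by
  rw [← sum_product', ← sum_filter]
  refine sum_nbij' (fun p => M - p.2) (fun i => (M + 1 + i, M - i)) ?_ ?_ ?_ ?_ ?_
  · simp only [mem_filter, mem_product, mem_range]; omega
  · simp only [mem_filter, mem_product, mem_range]; omega
  · simp only [mem_filter, mem_product, mem_range, Prod.forall, Prod.mk.injEq]; omega
  · simp only [mem_range]; omega
  · simp only [mem_filter, mem_product, mem_range, Prod.forall]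
    intro a b h
    congr 1 <;> omega

/-- The `2 × 2` minor of the matrix `(e (p - q))` in rows `a, b` and columns `j, k`. -/
def minorTwo (e : ℤ → R) (j k a b : ℤ) : R :=
  e (a - j) * e (b - k) - e (a - k) * e (b - j)

/-- The `4 × 4` minor of the matrix `(e (p - q))` in rows `a, b, c, d` and columns `0, 1, 2, 3`,
by Laplace expansion along the first two rows. -/
def minorFour (e : ℤ → R) (a b c d : ℤ) : R :=
  minorTwo e 0 1 a b * minorTwo e 2 3 c d - minorTwo e 0 2 a b * minorTwo e 1 3 c d
    + minorTwo e 0 3 a b * minorTwo e 1 2 c d + minorTwo e 1 2 a b * minorTwo e 0 3 c d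
    - minorTwo e 1 3 a b * minorTwo e 0 2 c d + minorTwo e 2 3 a b * minorTwo e 0 1 c d

lemma shiftDet_four (e : ℤ → R) (p : Fin 4 → ℤ) :
    shiftDet e p = minorFour e (p 0 + 3) (p 1 + 3) (p 2 + 3) (p 3 + 3) := by
  have h (q : ℤ) : q + 3 - 0 = q + 3 ∧ q + 3 - 1 = q + 2 ∧ q + 3 - 2 = q + 1 ∧ q + 3 - 3 = q := by
    omega
  unfold shiftDet minorFour minorTwo
  simp only [h, Matrix.det_succ_row_zero, Fin.sum_univ_succ]
  simp [Fin.succAbove, Fin.lt_def]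
  ring

lemma sum_minorTwo_one {e : ℤ → R} (he : ∀ i < 0, e i = 0) {j : ℤ} (hj : 0 ≤ j) (M : ℕ) :
    ∑ i ∈ range (M + 1), minorTwo e j (j + 1) ((M : ℤ) + 1 + i) (M - i) = -e (M - j) ^ 2 := by
  let h : ℕ → R := fun i => e (M - j + i) * e (M - j - i)
  have hterm (i : ℕ) :
      minorTwo e j (j + 1) ((M : ℤ) + 1 + i) (M - i) = h (i + 1) - h i := by
    simp only [minorTwo, h]
    push_cast
    ring_nf
  have hend : h (M + 1) = 0 := by
    simp only [h]
    rw [he (M - j - (M + 1 : ℕ)) (by push_cast; omega), mul_zero]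
  simp only [hterm]
  rw [sum_range_sub, hend]
  simp only [h, Nat.cast_zero, add_zero, sub_zero]
  ring

lemma sum_minorTwo_two {e : ℤ → R} (he : ∀ i < 0, e i = 0) {j : ℤ} (hj : 0 ≤ j) (M : ℕ) :
    ∑ i ∈ range (M + 1), minorTwo e j (j + 2) ((M : ℤ) + 1 + i) (M - i) =
      -(2 * e (M - j) * e (M - j - 1)) := by
  let h : ℕ → R := fun i => e (M - j - 1 + i) * e (M - j - i)
  have hterm (i : ℕ) :
      minorTwo e j (j + 2) ((M : ℤ) + 1 + i) (M - i) =
        (h (i + 1) - h i) + (h (i + 1 + 1) - h (i + 1)) := by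
    simp only [minorTwo, h]
    push_cast
    ring_nf
  have hend (i : ℕ) (hi : M < i) : h i = 0 := by
    simp only [h]
    rw [he (M - j - i) (by omega), mul_zero]
  simp only [hterm]
  rw [sum_add_distrib, sum_range_sub, sum_range_sub fun i => h (i + 1), hend (M + 1) (by omega),
    hend (M + 1 + 1) (by omega)]
  simp only [h]
  push_cast
  ring_nf

lemma sum_minorTwo_three {e : ℤ → R} (he : ∀ i < 0, e i = 0) {j : ℤ} (hj : 0 ≤ j) (M : ℕ) :
    ∑ i ∈ range (M + 1), minorTwo e j (j + 3) ((M : ℤ) + 1 + i) (M - i) =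
      -(2 * e (M - j) * e (M - j - 2) + e (M - j - 1) ^ 2) := by
  let h : ℕ → R := fun i => e (M - j - 2 + i) * e (M - j - i)
  have hterm (i : ℕ) :
      minorTwo e j (j + 3) ((M : ℤ) + 1 + i) (M - i) =
        (h (i + 1) - h i) + (h (i + 1 + 1) - h (i + 1)) + (h (i + 1 + 2) - h (i + 2)) := by
    simp only [minorTwo, h]
    push_cast
    ring_nf
  have hend (i : ℕ) (hi : M < i) : h i = 0 := by
    simp only [h]
    rw [he (M - j - i) (by omega), mul_zero]
  simp only [hterm]
  rw [sum_add_distrib, sum_add_distrib, sum_range_sub, sum_range_sub fun i => h (i + 1),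
    sum_range_sub fun i => h (i + 2), hend (M + 1) (by omega), hend (M + 1 + 1) (by omega),
    hend (M + 1 + 2) (by omega)]
  simp only [h]
  push_cast
  ring_nf

/-- Twice the summand of the quartic identity, up to a shift in its first term. -/
def quarticTerm (e : ℤ → R) (r M : ℤ) : R :=
  e M ^ 2 * e (r - 1 - M) ^ 2 - 4 * e M * e (M - 1) * e (r - M) * e (r - M - 1)
    + (2 * e M * e (M - 2) + e (M - 1) ^ 2) * e (r - M) ^ 2

lemma sum_quarticTerm {e : ℤ → R} (he : ∀ i < 0, e i = 0) (r : ℕ) :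
    ∑ M ∈ range (r + 2), quarticTerm e r M =
      2 * ∑ k ∈ range (r + 1),
        (e ((k : ℤ) - 1) ^ 2 * e ((r : ℤ) - k) ^ 2 +
          e ((k : ℤ) - 2) * e (k : ℤ) * e ((r : ℤ) - k) ^ 2 -
          2 * e ((k : ℤ) - 1) * e (k : ℤ) * e ((r : ℤ) - k - 1) * e ((r : ℤ) - k)) := by
  have hlast : quarticTerm e r ((r + 1 : ℕ) : ℤ) = 0 := by
    unfold quarticTerm
    rw [he (r - 1 - (r + 1 : ℕ)) (by push_cast; omega), he (r - (r + 1 : ℕ)) (by push_cast; omega)]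
    ring
  have hshift : ∑ M ∈ range (r + 1), e M ^ 2 * e (r - 1 - M) ^ 2 =
      ∑ k ∈ range (r + 1), e ((k : ℤ) - 1) ^ 2 * e ((r : ℤ) - k) ^ 2 := by
    rw [sum_range_succ, sum_range_succ', he ((r : ℤ) - 1 - r) (by omega),
      he (((0 : ℕ) : ℤ) - 1) (by simp)]
    simp only [ne_eq, OfNat.ofNat_ne_zero, not_false_eq_true, zero_pow, mul_zero, zero_mul,
      add_zero]
    refine sum_congr rfl fun M _ => ?_
    push_cast
    ring_nf
  rw [sum_range_succ, hlast, add_zero]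
  simp only [quarticTerm]
  rw [sum_add_distrib, sum_sub_distrib, hshift, ← sum_sub_distrib, ← sum_add_distrib, mul_sum]
  exact sum_congr rfl fun k _ => by ring

lemma sum_minorFour_eq_sum_quarticTerm {e : ℤ → R} (he : ∀ i < 0, e i = 0) (r : ℕ) :
    ∑ a ∈ range (2 * r + 5), ∑ b ∈ range (2 * r + 5), ∑ c ∈ range (2 * r + 5),
      ∑ d ∈ range (2 * r + 5), (if b < a ∧ d < c ∧ Odd (a + b) ∧ Odd (c + d)
        then (if a + b + c + d = 2 * (r + 1) + 2 then minorFour e a b c d else 0) else 0) =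
      2 * ∑ M ∈ range (r + 2), quarticTerm e r M := by
  let S (j k : ℤ) (M : ℕ) : R := ∑ a ∈ range (2 * r + 5), ∑ b ∈ range (2 * r + 5),
    if b < a ∧ a + b = 2 * M + 1 then minorTwo e j k a b else 0
  have hS (j k : ℤ) (M : ℕ) (hM : M < r + 2) :
      S j k M = ∑ i ∈ range (M + 1), minorTwo e j k ((M : ℤ) + 1 + i) (M - i) := by
    simp only [S]
    rw [sum_pairs_eq_sum_range (by omega) fun a b : ℕ => minorTwo e j k a b]
    refine sum_congr rfl fun i hi => ?_
    rw [mem_range] at hi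
    push_cast [Nat.cast_sub (show i ≤ M by omega)]
    rfl
  have hprod (j k j' k' : ℤ) :
      ∑ a ∈ range (2 * r + 5), ∑ b ∈ range (2 * r + 5), ∑ c ∈ range (2 * r + 5),
        ∑ d ∈ range (2 * r + 5), (if b < a ∧ d < c ∧ Odd (a + b) ∧ Odd (c + d)
          then (if a + b + c + d = 2 * (r + 1) + 2
            then minorTwo e j k a b * minorTwo e j' k' c d else 0) else 0) =
        ∑ M ∈ range (r + 2), S j k M * S j' k' (r + 1 - M) :=
    sum_mul_sum_odd_pairs (K := r + 1) (fun a b : ℕ => minorTwo e j k a b)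
      (fun a b : ℕ => minorTwo e j' k' a b) _
  have hexpand (a b c d : ℕ) :
      (if b < a ∧ d < c ∧ Odd (a + b) ∧ Odd (c + d)
        then (if a + b + c + d = 2 * (r + 1) + 2 then minorFour e a b c d else 0) else 0) =
      let I (x : R) : R := if b < a ∧ d < c ∧ Odd (a + b) ∧ Odd (c + d)
        then (if a + b + c + d = 2 * (r + 1) + 2 then x else 0) else 0
      I (minorTwo e 0 1 a b * minorTwo e 2 3 c d) - I (minorTwo e 0 2 a b * minorTwo e 1 3 c d)
        + I (minorTwo e 0 3 a b * minorTwo e 1 2 c d)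
        + I (minorTwo e 1 2 a b * minorTwo e 0 3 c d)
        - I (minorTwo e 1 3 a b * minorTwo e 0 2 c d)
        + I (minorTwo e 2 3 a b * minorTwo e 0 1 c d) := by
    dsimp only
    split_ifs
    · rfl
    all_goals simp
  simp only [hexpand, sum_add_distrib, sum_sub_distrib, hprod]
  simp only [← sum_add_distrib, ← sum_sub_distrib]
  have hterm : ∀ M ∈ range (r + 2),
      S 0 1 M * S 2 3 (r + 1 - M) - S 0 2 M * S 1 3 (r + 1 - M) + S 0 3 M * S 1 2 (r + 1 - M)
        + S 1 2 M * S 0 3 (r + 1 - M) - S 1 3 M * S 0 2 (r + 1 - M)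
        + S 2 3 M * S 0 1 (r + 1 - M) =
      quarticTerm e r M + quarticTerm e r ((r + 1 - M : ℕ) : ℤ) := by
    intro M hM
    rw [mem_range] at hM
    have v₁ (j : ℤ) (hj : 0 ≤ j) (M : ℕ) (hM : M < r + 2) :=
      (hS j (j + 1) M hM).trans (sum_minorTwo_one he hj M)
    have v₂ (j : ℤ) (hj : 0 ≤ j) (M : ℕ) (hM : M < r + 2) :=
      (hS j (j + 2) M hM).trans (sum_minorTwo_two he hj M)
    have v₃ := fun M hM => (hS 0 3 M hM).trans (sum_minorTwo_three he le_rfl M)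
    have v01 := v₁ 0 le_rfl
    have v12 := v₁ 1 zero_le_one
    have v23 := v₁ 2 zero_le_two
    have v02 := v₂ 0 le_rfl
    have v13 := v₂ 1 zero_le_one
    norm_num only at v01 v12 v23 v02 v13
    have hM' : r + 1 - M < r + 2 := by omega
    rw [v01 M hM, v01 _ hM', v12 M hM, v12 _ hM', v23 M hM, v23 _ hM', v02 M hM, v02 _ hM',
      v13 M hM, v13 _ hM', v₃ M hM, v₃ _ hM', Nat.cast_sub (show M ≤ r + 1 by omega)]
    unfold quarticTerm
    push_cast
    ring_nf
  rw [sum_congr rfl hterm, sum_add_distrib, two_mul]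
  congr 1
  exact sum_range_reflect (fun M => quarticTerm e r (M : ℤ)) (r + 2)

end ShuffleSum

section SchurExpansion

open Finset

/-- The column lengths of the partition `(4^{i4}, 3^{2 i3}, 2^{2 i2}, 1^{2 i1})`. -/
def columnLengths (i4 i3 i2 i1 : ℕ) : Fin 4 → ℕ :=
  ![i4 + 2 * i3 + 2 * i2 + 2 * i1, i4 + 2 * i3 + 2 * i2, i4 + 2 * i3, i4]

lemma antitone_columnLengths (i4 i3 i2 i1 : ℕ) : Antitone (columnLengths i4 i3 i2 i1) := by
  rw [Fin.antitone_iff_succ_le]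
  intro i
  fin_cases i <;> simp [columnLengths]

lemma isColumnDiagram_columnLengths (i4 i3 i2 i1 : ℕ) :
    IsColumnDiagram (columnLengths i4 i3 i2 i1)
      (cellsOf (rl i4 i3 i2 i1) (i4 + 2 * i3 + 2 * i2 + 2 * i1) 4) := by
  rintro ⟨i, j⟩
  rw [cellsOf, mem_filter, mem_product, mem_range, mem_range]
  simp only [rl]
  by_cases hj : j < 4
  · interval_cases j <;> simp [columnLengths] <;> grind
  · simp [hj]

lemma schur_rl_eq_minorFour (m i4 i3 i2 i1 : ℕ) :
    schur m (rl i4 i3 i2 i1) (i4 + 2 * i3 + 2 * i2 + 2 * i1) 4 =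
      minorFour (esymmInt (MvPolynomial.X : Fin m → MvPolynomial (Fin m) ℤ))
        ((i4 + 2 * i3 + 2 * i2 + 2 * i1 + 3 : ℕ) : ℤ) ((i4 + 2 * i3 + 2 * i2 + 2 : ℕ) : ℤ)
        ((i4 + 2 * i3 + 1 : ℕ) : ℤ) (i4 : ℤ) := by
  rw [schur_eq_tableauSum, tableauSum_eq_shiftDet _ (antitone_columnLengths i4 i3 i2 i1)
    (isColumnDiagram_columnLengths i4 i3 i2 i1), shiftDet_four]
  congr 1 <;> simp [colIndex, columnLengths] <;> ring

variable {R : Type*} [CommRing R]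

lemma sum_alternating_eq_sum_tuples {r : ℕ} (hr : 1 ≤ r) (f : ℕ → ℕ → ℕ → ℕ → R) :
    ∑ a ∈ range (2 * r + 5), ∑ b ∈ range (2 * r + 5), ∑ c ∈ range (2 * r + 5),
      ∑ d ∈ range (2 * r + 5),
        (if d < c ∧ c < b ∧ b < a ∧ Odd (a + b) ∧ Odd (b + c) ∧ Odd (c + d)
          then (if a + b + c + d = 2 * (r + 1) + 2 then f a b c d else 0) else 0) =
      ∑ t ∈ (range (2 * r) ×ˢ range (2 * r) ×ˢ range (2 * r) ×ˢ range (2 * r)).filter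
          (fun t : ℕ × ℕ × ℕ × ℕ =>
            4 * t.1 + 6 * t.2.1 + 4 * t.2.2.1 + 2 * t.2.2.2 = 2 * r - 2),
        f (t.1 + 2 * t.2.1 + 2 * t.2.2.1 + 2 * t.2.2.2 + 3) (t.1 + 2 * t.2.1 + 2 * t.2.2.1 + 2)
          (t.1 + 2 * t.2.1 + 1) t.1 := by
  have hprod (g : ℕ → ℕ → ℕ → ℕ → R) (s : Finset ℕ) :
      ∑ a ∈ s, ∑ b ∈ s, ∑ c ∈ s, ∑ d ∈ s, g a b c d =
        ∑ q ∈ s ×ˢ s ×ˢ s ×ˢ s, g q.1 q.2.1 q.2.2.1 q.2.2.2 := by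
    simp only [sum_product]
  rw [hprod]
  simp only [← ite_and, ← sum_filter]
  symm
  refine sum_nbij' (fun t => (t.1 + 2 * t.2.1 + 2 * t.2.2.1 + 2 * t.2.2.2 + 3,
      t.1 + 2 * t.2.1 + 2 * t.2.2.1 + 2, t.1 + 2 * t.2.1 + 1, t.1))
    (fun q => (q.2.2.2, (q.2.2.1 - 1 - q.2.2.2) / 2, (q.2.1 - 1 - q.2.2.1) / 2,
      (q.1 - 1 - q.2.1) / 2)) ?_ ?_ ?_ ?_ ?_
  · simp only [mem_filter, mem_product, mem_range, Prod.forall, Nat.odd_iff]; omega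
  · simp only [mem_filter, mem_product, mem_range, Prod.forall, Nat.odd_iff]; omega
  · rintro ⟨i4, i3, i2, i1⟩ -
    simp only [Prod.mk.injEq, true_and]
    omega
  · rintro ⟨a, b, c, d⟩ h
    simp only [mem_filter, Nat.odd_iff] at h
    simp only [Prod.mk.injEq, and_true]
    omega
  · intros; rfl

end SchurExpansion

/-- Schur expansion: for `m ≥ 1` and `r ≥ 1`,
`∑_{k=0}^r (e_{k-1}^2 e_{r-k}^2 + e_{k-2} e_k e_{r-k}^2 - 2 e_{k-1} e_k e_{r-k-1} e_{r-k})
  = ∑_λ s_λ(x_1,…,x_m)`,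
where `λ` runs over all partitions of `2r - 2` with all parts in `{1,2,3,4}` in which
each of the parts `1`, `2`, `3` occurs an even number of times, i.e. over all
`λ = (4^{i4}, 3^{2 i3}, 2^{2 i2}, 1^{2 i1})` with `4 i4 + 6 i3 + 4 i2 + 2 i1 = 2r - 2`. -/
theorem schur_positivity_identity (m : ℕ) (hm : 1 ≤ m) (r : ℕ) (hr : 1 ≤ r) :
    ∑ k ∈ Finset.range (r + 1),
        (E m ((k : ℤ) - 1) ^ 2 * E m ((r : ℤ) - k) ^ 2 +
          E m ((k : ℤ) - 2) * E m (k : ℤ) * E m ((r : ℤ) - k) ^ 2 -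
          2 * E m ((k : ℤ) - 1) * E m (k : ℤ) * E m ((r : ℤ) - k - 1) * E m ((r : ℤ) - k)) =
      ∑ t ∈ (Finset.range (2 * r) ×ˢ Finset.range (2 * r) ×ˢ Finset.range (2 * r) ×ˢ
              Finset.range (2 * r)).filter
          (fun t : ℕ × ℕ × ℕ × ℕ =>
            4 * t.1 + 6 * t.2.1 + 4 * t.2.2.1 + 2 * t.2.2.2 = 2 * r - 2),
        schur m (rl t.1 t.2.1 t.2.2.1 t.2.2.2)
          (t.1 + 2 * t.2.1 + 2 * t.2.2.1 + 2 * t.2.2.2) 4 := by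
  let e : ℤ → MvPolynomial (Fin m) ℤ := esymmInt MvPolynomial.X
  have he : ∀ j < 0, e j = 0 := fun j hj => esymmInt_of_neg _ hj
  simp only [schur_rl_eq_minorFour, esymmInt_eq_E]
  have hint := sum_interleavings (Finset.range (2 * r + 5))
    (fun a b c d => if a + b + c + d = 2 * (r + 1) + 2 then minorFour e a b c d else 0)
    (fun a b c d => by
      simp only [add_comm b a, minorFour, minorTwo]
      split_ifs <;> ring)
    (fun a b c d => by
      simp only [add_right_comm a c b, minorFour, minorTwo]
      split_ifs <;> ring)
    (fun a b c d => by
      simp only [add_right_comm (a + b) d c, minorFour, minorTwo]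
      split_ifs <;> ring)
    (fun a b d => by
      simp only [minorFour, minorTwo]
      split_ifs <;> ring)
  rw [sum_minorFour_eq_sum_quarticTerm he, sum_quarticTerm he,
    sum_alternating_eq_sum_tuples hr fun a b c d : ℕ => minorFour e a b c d, ← mul_assoc,
    show (2 * 2 : MvPolynomial (Fin m) ℤ) = 4 by norm_num] at hint
  exact mul_left_cancel₀ (by norm_num) hint
end
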